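/- The DSER elementary transformation E*_β preserves the bilinear form on M = Q ⊥ H(P): for all m₁, m₂ ∈ M, ⟨E*_β(m₁), E*_β(m₂)⟩ = ⟨m₁, m₂⟩. -/

import Mathlib

/-- The DSER elementary orthogonal transformation E*_β on Q ⊥ H(P),
where βs plays the role of β* = d⁻¹ ∘ βᵗ ∘ i : P → Q. -/
def EdserStar {R Q P : Type*} [CommRing R] [AddCommGroup Q] [Module R Q]
    [AddCommGroup P] [Module R P] [Invertible (2 : R)]
    (β : Q →ₗ[R] Module.Dual R P) (βs : P →ₗ[R] Q) :
    Q × P × Module.Dual R P → Q × P × Module.Dual R P :=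
  fun m => (m.1 - βs m.2.1, m.2.1, m.2.2 + β m.1 - (⅟(2 : R)) • β (βs m.2.1))

/-- The bilinear form on M = Q ⊥ H(P): ⟨(z₁,x₁,f₁),(z₂,x₂,f₂)⟩ = ⟨z₁,z₂⟩ + f₂(x₁) + f₁(x₂). -/
def hypForm {R Q P : Type*} [CommRing R] [AddCommGroup Q] [Module R Q]
    [AddCommGroup P] [Module R P] (B : Q →ₗ[R] Q →ₗ[R] R)
    (m₁ m₂ : Q × P × Module.Dual R P) : R :=
  B m₁.1 m₂.1 + m₂.2.2 m₁.2.1 + m₁.2.2 m₂.2.1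

theorem dser_Ebeta_isometry {R Q P : Type*} [CommRing R] [AddCommGroup Q] [Module R Q]
    [AddCommGroup P] [Module R P] [Invertible (2 : R)]
    (B : Q →ₗ[R] Q →ₗ[R] R)
    (hsymm : ∀ x y, B x y = B y x)
    (hnd : ∀ x, (∀ y, B x y = 0) → x = 0)
    (β : Q →ₗ[R] Module.Dual R P) (βs : P →ₗ[R] Q)
    (hβs : ∀ x z, B (βs x) z = β z x) :
    ∀ m₁ m₂, hypForm B (EdserStar β βs m₁) (EdserStar β βs m₂) = hypForm B m₁ m₂ := by
  rintro ⟨z₁, x₁, f₁⟩ ⟨z₂, x₂, f₂⟩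
  have h1 : B z₁ (βs x₂) = β z₁ x₂ := by rw [hsymm, hβs]
  have h2 : β (βs x₁) x₂ = β (βs x₂) x₁ := by rw [← hβs, ← hβs, hsymm]
  have h3 : ⅟(2 : R) * 2 = 1 := invOf_mul_self _
  simp only [hypForm, EdserStar, map_sub, LinearMap.sub_apply, LinearMap.add_apply,
    LinearMap.smul_apply, smul_eq_mul, hβs, h1, h2]
  linear_combination (-(β (βs x₂) x₁)) * h3
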